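/- Let K be a field and let H be the generic r×s Hankel matrix in S = K[x₁,…,xₙ] with n = r+s−1. Then for every t ≤ min(r,s), the determinantal ideal I_t(H) is a Knutson ideal, i.e. there exists a polynomial f ∈ S whose leading term with respect to some term order is a squarefree monomial such that I_t(H) ∈ C_f. -/

import Mathlib

open MvPolynomial

/-- The leading exponent (degree) of a multivariate polynomial with respect to a
monomial order: the maximum of its support. -/
noncomputable def MonomialOrder.degreeOf {σ : Type*} {K : Type*} [CommSemiring K]
    (m : MonomialOrder σ) (f : MvPolynomial σ K) : σ →₀ ℕ :=
  m.toSyn.symm (f.support.sup m.toSyn)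

/-- The leading term `lt(f)` of a polynomial with respect to a monomial order. -/
noncomputable def MonomialOrder.leadTerm {σ : Type*} {K : Type*} [CommSemiring K]
    (m : MonomialOrder σ) (f : MvPolynomial σ K) : MvPolynomial σ K :=
  monomial (m.degreeOf f) (f.coeff (m.degreeOf f))

/-- The initial ideal `lt(I)` of an ideal, generated by leading terms of its
nonzero elements. -/
noncomputable def MonomialOrder.initialIdeal {σ : Type*} {K : Type*} [CommSemiring K]
    (m : MonomialOrder σ) (I : Ideal (MvPolynomial σ K)) : Ideal (MvPolynomial σ K) :=
  Ideal.span { g | ∃ f ∈ I, f ≠ 0 ∧ g = m.leadTerm f }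

/-- The leading term of `f` is a squarefree monomial. -/
def MonomialOrder.HasSqfreeLeadTerm {σ : Type*} {K : Type*} [CommSemiring K]
    (m : MonomialOrder σ) (f : MvPolynomial σ K) : Prop :=
  f ≠ 0 ∧ ∀ i, m.degreeOf f i ≤ 1

/-- The family `C_f` of Knutson ideals associated to `f` : the smallest family of ideals
containing `(f)`, closed under colon by arbitrary ideals, sums and intersections. -/
inductive KnutsonFamily {σ : Type*} {K : Type*} [CommRing K] (f : MvPolynomial σ K) :
    Ideal (MvPolynomial σ K) → Prop
  | base : KnutsonFamily f (Ideal.span {f})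
  | colon (I J : Ideal (MvPolynomial σ K)) : KnutsonFamily f I → KnutsonFamily f (I.colon J)
  | add (I J : Ideal (MvPolynomial σ K)) :
      KnutsonFamily f I → KnutsonFamily f J → KnutsonFamily f (I + J)
  | inter (I J : Ideal (MvPolynomial σ K)) :
      KnutsonFamily f I → KnutsonFamily f J → KnutsonFamily f (I ⊓ J)

/-- A squarefree monomial ideal : an ideal generated by squarefree monomials. -/
def IsSqfreeMonomialIdeal {σ : Type*} {K : Type*} [CommSemiring K]
    (J : Ideal (MvPolynomial σ K)) : Prop :=
  ∃ G : Set (MvPolynomial σ K),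
    (∀ g ∈ G, ∃ s : Finset σ, g = ∏ i ∈ s, X i) ∧ J = Ideal.span G

/-- `I_t(M)` : the ideal generated by the `t × t` minors of a matrix `M`. -/
noncomputable def minorsIdeal {R : Type*} [CommRing R] {r s : ℕ} (t : ℕ)
    (M : Matrix (Fin r) (Fin s) R) : Ideal R :=
  Ideal.span {d | ∃ (ρ : Fin t → Fin r) (γ : Fin t → Fin s),
    StrictMono ρ ∧ StrictMono γ ∧ d = (M.submatrix ρ γ).det}

/-- The generic `r × s` Hankel matrix with entries `x₁, …, x_{r+s-1}`
(zero-indexed: entry `(i,j)` is `X (i+j)`). -/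
noncomputable def hankelGen (K : Type*) [Field K] (r s : ℕ) :
    Matrix (Fin r) (Fin s) (MvPolynomial (Fin (r + s - 1)) K) :=
  fun i j => MvPolynomial.X ⟨i.1 + j.1, by have := i.isLt; have := j.isLt; omega⟩

namespace HK

/-- `pt` restricted to `[a,b)` is a sum of `d` geometric progressions. -/
def HPt {F : Type*} [Field F] {n : ℕ} (a b d : ℕ) (pt : Fin n → F) : Prop :=
  ∃ y z : Fin d → F, ∀ j : Fin n, a ≤ j.1 → j.1 < b → pt j = ∑ k, y k * z k ^ j.1

/-- The monomial with exponent `m` is divisible by a product of `t` variables in `[a,b)` with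
indices at mutual distance at least two. -/
def Chain {n : ℕ} (a b t : ℕ) (m : Fin n →₀ ℕ) : Prop :=
  ∃ c : Fin t → Fin n, (∀ k, a ≤ (c k).1 ∧ (c k).1 < b ∧ m (c k) ≠ 0) ∧
    ∀ k l : Fin t, k ≤ l → (c k).1 + 2 * l.1 ≤ (c l).1 + 2 * k.1

theorem exists_pt_novar {K F : Type*} [Field K] [Field F] [Infinite F] [Algebra K F] {n : ℕ}
    (a b d : ℕ) (p : MvPolynomial (Fin n) K) (hp : p ≠ 0)
    (h : ∀ m ∈ p.support, ∀ j : Fin n, a ≤ j.1 → j.1 < b → m j = 0) :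
    ∃ pt : Fin n → F, HPt a b d pt ∧ aeval pt p ≠ 0 := by
  have hq : MvPolynomial.map (algebraMap K F) p ≠ 0 := by
    intro h0
    apply hp
    exact MvPolynomial.map_injective _ (algebraMap K F).injective (by simpa using h0)
  obtain ⟨w, hw⟩ : ∃ w : Fin n → F, MvPolynomial.eval w (MvPolynomial.map (algebraMap K F) p) ≠ 0 := by
    by_contra hcon
    push Not at hcon
    exact hq (MvPolynomial.funext (by simpa using hcon))
  refine ⟨fun j => if a ≤ j.1 ∧ j.1 < b then 0 else w j, ⟨0, 0, ?_⟩, ?_⟩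
  · intro j h1 h2
    simp [h1, h2]
  · rw [MvPolynomial.eval_map, eval₂_eq'] at hw
    rw [aeval_def, eval₂_eq']
    convert hw using 1
    refine Finset.sum_congr rfl fun m hm => ?_
    congr 1
    refine Finset.prod_congr rfl fun j _ => ?_
    by_cases hj : a ≤ j.1 ∧ j.1 < b
    · simp [h m hm j hj.1 hj.2]
    · rw [if_neg hj]

theorem exists_pt {K F : Type*} [Field K] [Field F] [Infinite F] [Algebra K F] {n : ℕ}
    (b d : ℕ) : ∀ (a : ℕ) (p : MvPolynomial (Fin n) K), p ≠ 0 →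
    (∀ m ∈ p.support, ¬ Chain a b (d+1) m) →
    ∃ pt : Fin n → F, HPt a b d pt ∧ aeval pt p ≠ 0 := by
  classical
  induction d with
  | zero =>
    intro a p hp h
    refine exists_pt_novar a b 0 p hp fun m hm j h1 h2 => ?_
    by_contra h3
    exact h m hm ⟨fun _ => j, fun _ => ⟨h1, h2, h3⟩, fun k l _ => by
      have h4 := k.2
      have h5 := l.2
      show j.1 + 2 * l.1 ≤ j.1 + 2 * k.1
      omega⟩
  | succ d ih =>
    intro a p hp h
    by_cases hv : ∀ m ∈ p.support, ∀ j : Fin n, a ≤ j.1 → j.1 < b → m j = 0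
    · exact exists_pt_novar a b _ p hp hv
    have hex : ∃ i : ℕ, ∃ hi : i < n, a ≤ i ∧ i < b ∧ ∃ m ∈ p.support, m ⟨i, hi⟩ ≠ 0 := by
      push Not at hv
      obtain ⟨m, hm, j, h1, h2, h3⟩ := hv
      exact ⟨j.1, j.2, h1, h2, m, hm, h3⟩
    obtain ⟨hi, hia, hib, m0, hm0, hm0i⟩ := Nat.find_spec hex
    have hmin : ∀ m ∈ p.support, ∀ j : Fin n, a ≤ j.1 → j.1 < Nat.find hex → m j = 0 := by
      intro m hm j h1 h2
      by_contra h3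
      exact Nat.find_min hex h2 ⟨j.2, h1, by omega, m, hm, h3⟩
    generalize Nat.find hex = i at *
    set I : Fin n := ⟨i, hi⟩ with hI
    obtain ⟨m1, hm1, hmax⟩ := Finset.exists_max_image p.support (fun m => m I) ⟨m0, hm0⟩
    set A := m1 I with hA
    have hApos : A ≠ 0 := by
      have := hmax m0 hm0
      intro h0
      apply hm0i
      simp only [h0] at this
      omega
    -- the part of `p` with maximal exponent at `i`
    set T := p.support.filter (fun m => m I = A) with hT
    set q : MvPolynomial (Fin n) K := ∑ m ∈ T, monomial m (p.coeff m) with hq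
    have hqc : ∀ m, q.coeff m = if m ∈ T then p.coeff m else 0 := by
      intro m
      rw [hq, coeff_sum]
      simp [coeff_monomial]
    have hqs : ∀ m ∈ q.support, m ∈ T := by
      intro m hm
      rw [mem_support_iff, hqc] at hm
      by_contra h0
      simp [h0] at hm
    have hq0 : q ≠ 0 := by
      intro h0
      have := hqc m1
      rw [h0, if_pos (by rw [hT, Finset.mem_filter]; exact ⟨hm1, rfl⟩)] at this
      exact (mem_support_iff.1 hm1) (by simpa using this.symm)
    obtain ⟨x, ⟨y, z, hyz⟩, hx⟩ := ih (i+2) q hq0 (by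
      rintro m hm ⟨c, hc1, hc2⟩
      have hmT := hqs m hm
      rw [hT, Finset.mem_filter] at hmT
      refine h m hmT.1 ⟨Fin.cons I c, ?_, ?_⟩
      · intro k
        refine Fin.cases ?_ (fun k => ?_) k
        · simp only [Fin.cons_zero]
          exact ⟨hia, hib, by rw [hmT.2]; exact hApos⟩
        · simp only [Fin.cons_succ]
          have := hc1 k
          exact ⟨by omega, this.2.1, this.2.2⟩
      · intro k l
        refine Fin.cases ?_ (fun k => ?_) k <;> refine Fin.cases ?_ (fun l => ?_) l
        · simp
        · intro _
          simp only [Fin.cons_zero, Fin.cons_succ, Fin.val_succ, Fin.val_zero]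
          have h1 := hc1 0
          have h2 := hc2 0 l (Fin.zero_le _)
          simp only [Fin.val_zero] at h2
          simp only [hI]
          omega
        · intro hkl
          exact absurd hkl (by simp)
        · intro hkl
          have := hc2 k l (by simpa using hkl)
          simp only [Fin.cons_succ, Fin.val_succ]
          omega)
    -- the base sequence
    set x0 : ℕ → F := fun j => ∑ k, y k * z k ^ j with hx0
    set W : F := if h : i + 1 < n then x ⟨i+1, h⟩ - x0 (i+1) else 0 with hW
    set g : Fin n → Polynomial F := fun j =>
      if j.1 = i then 1 + Polynomial.C (x0 i) * Polynomial.X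
      else if i < j.1 ∧ j.1 < b then Polynomial.C (x0 j.1) +
          (Polynomial.C W + Polynomial.X) ^ (j.1 - i) * Polynomial.X ^ (j.1 - i - 1)
      else Polynomial.C (x j) with hg
    have hg0 : ∀ j : Fin n, j ≠ I → (g j).eval 0 = x j := by
      intro j hj
      have hj' : j.1 ≠ i := fun h => hj (Fin.ext h)
      simp only [hg, if_neg hj']
      split_ifs with h1
      · by_cases h2 : j.1 = i + 1
        · have h3 : i + 1 < n := h2 ▸ j.2
          have h4 : j = ⟨i+1, h3⟩ := Fin.ext h2
          simp [hW, h3, h4]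
        · have : j.1 - i - 1 ≠ 0 := by omega
          rw [hyz j (by omega) h1.2]
          simp only [Polynomial.eval_mul, Polynomial.eval_C, Polynomial.eval_pow,
            Polynomial.eval_X, Polynomial.eval_add, zero_pow this, mul_zero, add_zero, hx0]
      · simp
    have hgI : (g I).eval 0 = 1 := by simp [hg, hI]
    set G : Polynomial F := ∑ m ∈ p.support, Polynomial.C (algebraMap K F (p.coeff m)) *
      (Polynomial.X ^ (A - m I) * ∏ j, g j ^ m j) with hG
    have hG0 : G.eval 0 ≠ 0 := by
      intro h0
      apply hx
      have e1 : aeval x q = x I ^ A * G.eval 0 := by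
        rw [hq, map_sum, hG, Polynomial.eval_finsetSum, Finset.mul_sum, hT, Finset.sum_filter]
        refine Finset.sum_congr rfl fun m hm => ?_
        have hle := hmax m hm
        split_ifs with hmI
        · rw [aeval_monomial]
          simp only [Polynomial.eval_mul, Polynomial.eval_C, Polynomial.eval_pow,
            hmI, Nat.sub_self, pow_zero, one_mul, Polynomial.eval_prod]
          rw [Finsupp.prod_fintype _ _ (by simp), ← Finset.mul_prod_erase _ _ (Finset.mem_univ I),
            ← Finset.mul_prod_erase Finset.univ (fun j => (g j).eval 0 ^ m j) (Finset.mem_univ I),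
            hgI, hmI, one_pow, one_mul, mul_left_comm]
          congr 2
          refine Finset.prod_congr rfl fun j hj => ?_
          rw [hg0 j (Finset.ne_of_mem_erase hj)]
        · have : A - m I ≠ 0 := by
            omega
          simp [this]
      rw [e1, h0, mul_zero]
    have hGne : G * (Polynomial.X * (Polynomial.C W + Polynomial.X)) ≠ 0 := by
      refine mul_ne_zero (fun h => hG0 (by simp [h])) (mul_ne_zero Polynomial.X_ne_zero ?_)
      rw [add_comm]
      exact Polynomial.X_add_C_ne_zero W
    obtain ⟨U, hU⟩ : ∃ U : F, (G * (Polynomial.X * (Polynomial.C W + Polynomial.X))).eval U ≠ 0 := by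
      by_contra hcon
      push Not at hcon
      exact hGne (Polynomial.funext (by simpa using hcon))
    simp only [Polynomial.eval_mul, Polynomial.eval_X, Polynomial.eval_add, Polynomial.eval_C,
      mul_ne_zero_iff] at hU
    obtain ⟨hU1, hU2, hU3⟩ := hU
    set Z : F := (W + U) * U with hZ
    have hZ0 : Z ≠ 0 := mul_ne_zero hU3 hU2
    set Y : F := U⁻¹ * (Z ^ i)⁻¹ with hY
    refine ⟨fun j => if a ≤ j.1 ∧ j.1 < b then x0 j.1 + Y * Z ^ j.1 else x j,
      ⟨Fin.cons Y y, Fin.cons Z z, ?_⟩, ?_⟩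
    · intro j h1 h2
      simp only [h1, h2, and_self, if_true]
      rw [Fin.sum_univ_succ]
      simp [hx0, add_comm]
    · have key : U ^ A * aeval (fun j : Fin n => if a ≤ j.1 ∧ j.1 < b then x0 j.1 + Y * Z ^ j.1
          else x j) p = G.eval U := by
        rw [aeval_def, eval₂_eq', hG, Polynomial.eval_finsetSum, Finset.mul_sum]
        refine Finset.sum_congr rfl fun m hm => ?_
        have hle : m I ≤ A := hmax m hm
        simp only [Polynomial.eval_mul, Polynomial.eval_C, Polynomial.eval_pow,
            Polynomial.eval_X, Polynomial.eval_prod]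
        rw [← Finset.mul_prod_erase _ _ (Finset.mem_univ I),
            ← Finset.mul_prod_erase Finset.univ (fun j => (g j).eval U ^ m j) (Finset.mem_univ I)]
        have e2 : ∀ j ∈ Finset.univ.erase I, (if a ≤ j.1 ∧ j.1 < b then x0 j.1 + Y * Z ^ j.1
            else x j) ^ m j = (g j).eval U ^ m j := by
          intro j hj
          have hj' : j.1 ≠ i := fun h => Finset.ne_of_mem_erase hj (Fin.ext h)
          by_cases hlt : a ≤ j.1 ∧ j.1 < i
          · simp [hmin m hm j hlt.1 hlt.2]
          · congr 1
            simp only [hg, if_neg hj']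
            by_cases hjb : i < j.1 ∧ j.1 < b
            · rw [if_pos hjb, if_pos ⟨by omega, hjb.2⟩]
              simp only [Polynomial.eval_mul, Polynomial.eval_C, Polynomial.eval_pow,
                Polynomial.eval_X, Polynomial.eval_add]
              congr 1
              obtain ⟨e, he⟩ : ∃ e, j.1 = i + (e + 1) := ⟨j.1 - i - 1, by omega⟩
              have he1 : j.1 - i = e + 1 := by omega
              have he2 : j.1 - i - 1 = e := by omega
              rw [he2, he1, he, hY, pow_add]
              field_simp
              rw [hZ, mul_pow]
              ring
            · rw [if_neg hjb, if_neg (by omega)]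
              simp
        rw [Finset.prod_congr rfl e2]
        have e3 : x0 i + Y * Z ^ i = U⁻¹ * (g I).eval U := by
          simp only [hg, hI, if_true]
          simp only [Polynomial.eval_mul, Polynomial.eval_C, Polynomial.eval_one,
                Polynomial.eval_X, Polynomial.eval_add]
          rw [hY]
          field_simp
          ring
        have e4 : U ^ A = U ^ (A - m I) * U ^ (m I) := by
          rw [← pow_add]
          congr 1
          omega
        rw [if_pos ⟨hia, hib⟩, show (I : ℕ) = i from rfl, e3, e4, mul_pow, inv_pow]
        field_simp
      intro h0
      rw [h0, mul_zero] at key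
      exact hU1 key.symm

end HK
namespace HK

/-- The variable `x_j`, extended by zero to all natural indices. -/
noncomputable def xv (n : ℕ) (K : Type*) [Field K] (j : ℕ) : MvPolynomial (Fin n) K :=
  if h : j < n then X ⟨j, h⟩ else 0

/-- Hankel determinant with rows `ρ` and columns `γ`. -/
noncomputable def hd {R : Type*} [CommRing R] (x : ℕ → R) {t : ℕ} (ρ γ : Fin t → ℕ) : R :=
  Matrix.det (Matrix.of fun i j => x (ρ i + γ j))

/-- Generic parametrization. -/
noncomputable def phi (n : ℕ) (K : Type*) [Field K] (a b d : ℕ) :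
    MvPolynomial (Fin n) K →ₐ[K] MvPolynomial (Fin d ⊕ (Fin d ⊕ Fin n)) K :=
  aeval fun j : Fin n => if a ≤ j.1 ∧ j.1 < b then
    ∑ k : Fin d, X (Sum.inl k) * X (Sum.inr (Sum.inl k)) ^ j.1 else X (Sum.inr (Sum.inr j))

/-- The prime ideal of the secant variety. -/
noncomputable def NN (n : ℕ) (K : Type*) [Field K] (a b d : ℕ) : Ideal (MvPolynomial (Fin n) K) :=
  RingHom.ker (phi n K a b d)

theorem NN_prime (n : ℕ) (K : Type*) [Field K] (a b d : ℕ) : (NN n K a b d).IsPrime :=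
  RingHom.ker_isPrime _

theorem aeval_eq_zero_of_mem {n : ℕ} {K F : Type*} [Field K] [Field F] [Algebra K F] {a b d : ℕ}
    {p : MvPolynomial (Fin n) K} (hp : p ∈ NN n K a b d) {pt : Fin n → F} (h : HPt a b d pt) :
    aeval pt p = 0 := by
  obtain ⟨y, z, hyz⟩ := h
  have e : (aeval (Sum.elim y (Sum.elim z pt)) : _ →ₐ[K] F).comp (phi n K a b d) = aeval pt := by
    apply MvPolynomial.algHom_ext
    intro j
    simp only [phi, AlgHom.comp_apply, aeval_X]
    split_ifs with hj
    · rw [hyz j hj.1 hj.2]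
      simp
    · simp
  rw [← e, AlgHom.comp_apply, (RingHom.mem_ker).1 hp, map_zero]

theorem hd_mem_NN {n : ℕ} {K : Type*} [Field K] {a b d : ℕ} (hb : b ≤ n) (ρ γ : Fin (d+1) → ℕ)
    (h : ∀ i j, a ≤ ρ i + γ j ∧ ρ i + γ j < b) : hd (xv n K) ρ γ ∈ NN n K a b d := by
  rw [NN, RingHom.mem_ker, hd]
  have e1 := (AlgHom.map_det (phi n K a b d) (Matrix.of fun i j => xv n K (ρ i + γ j)))
  refine e1.trans ?_
  have e2 : (phi n K a b d).mapMatrix (Matrix.of fun i j => xv n K (ρ i + γ j)) =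
      (Matrix.of fun (i : Fin (d+1)) (k : Fin (d+1)) => (Fin.cons 0
        (fun k => X (Sum.inl k) * X (Sum.inr (Sum.inl k)) ^ (ρ i)) : Fin (d+1) → MvPolynomial (Fin d ⊕ (Fin d ⊕ Fin n)) K) k) *
      (Matrix.of fun (k : Fin (d+1)) (j : Fin (d+1)) => (Fin.cons 0
        (fun k => X (Sum.inr (Sum.inl k)) ^ (γ j)) : Fin (d+1) → MvPolynomial (Fin d ⊕ (Fin d ⊕ Fin n)) K) k) := by
    ext1 i j
    have hij := h i j
    rw [Matrix.mul_apply, Fin.sum_univ_succ]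
    simp only [AlgHom.mapMatrix_apply, Matrix.map_apply, Matrix.of_apply, Fin.cons_zero,
      Fin.cons_succ, zero_mul, zero_add, xv, phi]
    rw [dif_pos (by omega), aeval_X, if_pos hij]
    refine Finset.sum_congr rfl fun k _ => ?_
    rw [pow_add, mul_assoc]
  rw [e2, Matrix.det_mul, Matrix.det_eq_zero_of_column_eq_zero 0 (by intro i; simp), zero_mul]

/-- exponent of `∏ x_{c k}` -/
noncomputable def expo (n : ℕ) {t : ℕ} (c : Fin t → ℕ) : Fin n →₀ ℕ :=
  ∑ k, if h : c k < n then Finsupp.single ⟨c k, h⟩ 1 else 0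

theorem expo_apply {n t : ℕ} (c : Fin t → ℕ) (j : Fin n) :
    expo n c j = (Finset.univ.filter fun k => c k = j.1).card := by
  rw [expo, Finsupp.finsetSum_apply, Finset.card_filter]
  refine Finset.sum_congr rfl fun k _ => ?_
  split_ifs with h1 h2 h2
  · rw [Finsupp.single_apply, if_pos (Fin.ext h2)]
  · rw [Finsupp.single_apply, if_neg]
    intro h
    exact h2 (by rw [← h])
  · have := j.2
    omega
  · rfl

theorem prod_xv {n t : ℕ} {K : Type*} [Field K] (c : Fin t → ℕ) (hc : ∀ k, c k < n) :
    ∏ k, xv n K (c k) = monomial (expo n c) 1 := by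
  rw [expo, monomial_sum_one]
  refine Finset.prod_congr rfl fun k _ => ?_
  rw [xv, dif_pos (hc k), dif_pos (hc k)]
  rfl

theorem expo_lt {n t : ℕ} (ρ γ : Fin t → ℕ) (hρ : StrictMono ρ) (hγ : StrictMono γ)
    (h : ∀ i j, ρ i + γ j < n) (σ : Equiv.Perm (Fin t)) (hσ : σ ≠ 1) :
    toLex (expo n (fun k => ρ (σ k) + γ k)) < toLex (expo n (fun k => ρ k + γ k)) := by
  have hex : ∃ i, σ i ≠ i := by
    by_contra hcon
    push Not at hcon
    exact hσ (Equiv.ext hcon)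
  obtain ⟨i, hi, hmin⟩ := WellFounded.has_min (wellFounded_lt (α := Fin t)) {i | σ i ≠ i} hex
  have h1 : ∀ k < i, σ k = k := fun k hk => by
    by_contra h0
    exact hmin k h0 hk
  have h2 : ∀ k, i ≤ k → i ≤ σ k := fun k hk => by
    by_contra h0
    push Not at h0
    have := σ.injective (h1 _ h0)
    rw [this] at h0
    exact absurd hk (not_le.2 h0)
  have h3 : ∀ k, i ≤ k → ρ i + γ i < ρ (σ k) + γ k := fun k hk => by
    have a1 := hρ.monotone (h2 k hk)
    have a2 := hγ.monotone hk
    rcases hk.eq_or_lt with rfl | hlt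
    · have := hρ (lt_of_le_of_ne (h2 i le_rfl) (Ne.symm hi))
      omega
    · have := hγ hlt
      omega
  rw [Finsupp.Lex.lt_iff]
  refine ⟨⟨ρ i + γ i, h i i⟩, ?_, ?_⟩
  · intro j hj
    have hj : j.1 < ρ i + γ i := hj
    show expo n (fun k => ρ (σ k) + γ k) j = expo n (fun k => ρ k + γ k) j
    rw [expo_apply, expo_apply]
    congr 1
    ext k
    simp only [Finset.mem_filter, Finset.mem_univ, true_and]
    rcases lt_or_ge k i with hk | hk
    · rw [h1 k hk]
    · have := h3 k hk
      have a1 := hρ.monotone hk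
      have a2 := hγ.monotone hk
      constructor <;> intro <;> omega
  · show expo n (fun k => ρ (σ k) + γ k) _ < expo n (fun k => ρ k + γ k) _
    rw [expo_apply, expo_apply]
    apply Finset.card_lt_card
    rw [Finset.ssubset_iff_of_subset]
    · refine ⟨i, by simp, ?_⟩
      simp only [Finset.mem_filter, Finset.mem_univ, true_and]
      have := h3 i le_rfl
      omega
    · intro k
      simp only [Finset.mem_filter, Finset.mem_univ, true_and]
      rcases lt_or_ge k i with hk | hk
      · rw [h1 k hk]
        exact id
      · have := h3 k hk
        omega

theorem hd_eq_sum {n t : ℕ} {K : Type*} [Field K] (ρ γ : Fin t → ℕ) (h : ∀ i j, ρ i + γ j < n) :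
    hd (xv n K) ρ γ = ∑ σ : Equiv.Perm (Fin t),
      monomial (expo n (fun k => ρ (σ k) + γ k)) (((Equiv.Perm.sign σ : ℤˣ) : ℤ) : K) := by
  rw [hd, Matrix.det_apply']
  refine Finset.sum_congr rfl fun σ _ => ?_
  simp only [Matrix.of_apply]
  rw [prod_xv _ (fun k => h _ _), ← mul_one (((Equiv.Perm.sign σ : ℤˣ) : ℤ) : K), ← C_mul_monomial]
  simp

theorem hd_coeff {n t : ℕ} {K : Type*} [Field K] (ρ γ : Fin t → ℕ) (hρ : StrictMono ρ)
    (hγ : StrictMono γ) (h : ∀ i j, ρ i + γ j < n) :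
    (hd (xv n K) ρ γ).coeff (expo n (fun k => ρ k + γ k)) = 1 := by
  classical
  rw [hd_eq_sum _ _ h, coeff_sum, Finset.sum_eq_single 1]
  · simp
  · intro σ _ hσ
    rw [coeff_monomial, if_neg]
    intro e
    have := expo_lt ρ γ hρ hγ h σ hσ
    rw [e] at this
    exact lt_irrefl _ this
  · simp

theorem hd_degree {n t : ℕ} {K : Type*} [Field K] (ρ γ : Fin t → ℕ) (hρ : StrictMono ρ)
    (hγ : StrictMono γ) (h : ∀ i j, ρ i + γ j < n) :
    MonomialOrder.lex.degree (hd (xv n K) ρ γ) = expo n (fun k => ρ k + γ k) := by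
  classical
  apply MonomialOrder.lex.toSyn.injective
  apply le_antisymm
  · rw [MonomialOrder.degree_le_iff]
    intro m hm
    rw [hd_eq_sum _ _ h] at hm
    obtain ⟨σ, -, hσ⟩ := Finset.mem_biUnion.1 (support_sum hm)
    have := Finset.mem_singleton.1 (support_monomial_subset hσ)
    rw [this, MonomialOrder.lex_le_iff]
    by_cases h1 : σ = 1
    · rw [h1]; rfl
    · exact (expo_lt ρ γ hρ hγ h σ h1).le
  · apply MonomialOrder.le_degree
    rw [mem_support_iff, hd_coeff _ _ hρ hγ h]
    exact one_ne_zero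

theorem idx_bounds {d a b : ℕ} (ρ γ : Fin (d+1) → ℕ) (hρ : StrictMono ρ) (hγ : StrictMono γ)
    (h0 : a ≤ ρ 0 + γ 0) (h1 : ρ (Fin.last d) + γ (Fin.last d) < b) (i j : Fin (d+1)) :
    a ≤ ρ i + γ j ∧ ρ i + γ j < b := by
  have a1 := hρ.monotone (Fin.zero_le i)
  have a2 := hγ.monotone (Fin.zero_le j)
  have a3 := hρ.monotone (Fin.le_last i)
  have a4 := hγ.monotone (Fin.le_last j)
  omega

theorem span_eq_NN {n : ℕ} {K : Type*} [Field K] {a b d : ℕ} (hb : b ≤ n)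
    (B : Set (MvPolynomial (Fin n) K))
    (hB : ∀ p ∈ B, ∃ ρ γ : Fin (d+1) → ℕ, StrictMono ρ ∧ StrictMono γ ∧ a ≤ ρ 0 + γ 0 ∧
      ρ (Fin.last d) + γ (Fin.last d) < b ∧ p = hd (xv n K) ρ γ)
    (hc : ∀ c : Fin (d+1) → ℕ, (∀ k, a ≤ c k ∧ c k < b) →
      (∀ k l : Fin (d+1), k ≤ l → c k + 2 * l.1 ≤ c l + 2 * k.1) →
      ∃ ρ γ : Fin (d+1) → ℕ, StrictMono ρ ∧ StrictMono γ ∧ (∀ k, ρ k + γ k = c k) ∧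
        hd (xv n K) ρ γ ∈ B) :
    Ideal.span B = NN n K a b d := by
  have hle : Ideal.span B ≤ NN n K a b d := by
    rw [Ideal.span_le]
    intro p hp
    obtain ⟨ρ, γ, hρ, hγ, h0, h1, rfl⟩ := hB p hp
    exact hd_mem_NN hb _ _ (idx_bounds ρ γ hρ hγ h0 h1)
  refine le_antisymm hle fun p hp => ?_
  obtain ⟨g, r, hpr, -, hr⟩ := MonomialOrder.lex.div_set (B := B) (by
    intro p hp
    obtain ⟨ρ, γ, hρ, hγ, h0, h1, rfl⟩ := hB p hp
    have hidx : ∀ i j, ρ i + γ j < n := fun i j =>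
      lt_of_lt_of_le (idx_bounds ρ γ hρ hγ h0 h1 i j).2 hb
    rw [MonomialOrder.leadingCoeff, hd_degree ρ γ hρ hγ hidx, hd_coeff ρ γ hρ hγ hidx]
    exact isUnit_one) p
  have hlin : Finsupp.linearCombination _ (fun (b : B) ↦ (b : MvPolynomial (Fin n) K)) g ∈
      Ideal.span B := by
    rw [Finsupp.linearCombination_apply]
    refine Ideal.sum_mem _ fun b _ => ?_
    exact Ideal.mul_mem_left _ _ (Ideal.subset_span b.2)
  have hrN : r ∈ NN n K a b d := by
    have : r = p - Finsupp.linearCombination _ (fun (b : B) ↦ (b : MvPolynomial (Fin n) K)) g := by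
      rw [hpr]; ring
    rw [this]
    exact sub_mem hp (hle hlin)
  have hr0 : r = 0 := by
    by_contra hr0
    obtain ⟨pt, hpt, hne⟩ := exists_pt (F := AlgebraicClosure K) b d a r hr0 (by
      rintro m hm ⟨c, hc1, hc2⟩
      obtain ⟨ρ, γ, hρ, hγ, hsum, hmem⟩ := hc (fun k => (c k).1)
        (fun k => ⟨(hc1 k).1, (hc1 k).2.1⟩) hc2
      apply hr m hm _ hmem
      have hidx : ∀ i j, ρ i + γ j < n := fun i j =>
        lt_of_lt_of_le (idx_bounds ρ γ hρ hγ (a := a) (b := b) (by rw [hsum]; exact (hc1 0).1)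
          (by rw [hsum]; exact (hc1 _).2.1) i j).2 hb
      rw [hd_degree ρ γ hρ hγ hidx]
      intro j
      rw [expo_apply]
      by_cases hj : ∃ k, c k = j
      · obtain ⟨k, rfl⟩ := hj
        refine le_trans ?_ (Nat.one_le_iff_ne_zero.2 (hc1 k).2.2)
        rw [Finset.card_le_one]
        intro k1 hk1 k2 hk2
        simp only [Finset.mem_filter, Finset.mem_univ, true_and] at hk1 hk2
        exact (hρ.add hγ).injective (hk1.trans hk2.symm)
      · rw [Finset.filter_false_of_mem, Finset.card_empty]
        · exact Nat.zero_le _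
        · intro k _ h
          rw [hsum] at h
          exact hj ⟨k, Fin.ext h⟩)
    exact hne (aeval_eq_zero_of_mem hrN hpt)
  rw [hpr, hr0, add_zero]
  exact hlin

end HK
namespace HK

/-! ### Determinantal identities -/

theorem hd_map {R R' : Type*} [CommRing R] [CommRing R'] (f : R →+* R') (x : ℕ → R) {t : ℕ}
    (ρ γ : Fin t → ℕ) : f (hd x ρ γ) = hd (fun j => f (x j)) ρ γ := by
  rw [hd, RingHom.map_det]
  rfl

theorem lin_adj {R : Type*} [CommRing R] {d : ℕ} (M : Matrix (Fin (d+1)) (Fin (d+1)) R)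
    (w : Fin (d+1) → R) (e : R) (h0 : ∑ i, w i * M i 0 = e)
    (h : ∀ j : Fin d, ∑ i, w i * M i j.succ = 0) (k : Fin (d+1)) :
    w k * M.det = e * M.adjugate 0 k := by
  have h1 : Matrix.vecMul w M = fun j => if j = 0 then e else 0 := by
    ext j
    simp only [Matrix.vecMul, dotProduct]
    refine Fin.cases ?_ (fun j => ?_) j
    · simpa using h0
    · simpa using h j
  have h2 : Matrix.vecMul (Matrix.vecMul w M) M.adjugate = M.det • w := by
    rw [Matrix.vecMul_vecMul, Matrix.mul_adjugate, Matrix.vecMul_smul, Matrix.vecMul_one]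
  have h3 := congrFun h2 k
  rw [h1] at h3
  simp only [Matrix.vecMul, dotProduct, ite_mul, zero_mul, Finset.sum_ite_eq', Finset.mem_univ,
    if_true, Pi.smul_apply, smul_eq_mul] at h3
  rw [h3, mul_comm]

theorem cof_sum {R : Type*} [CommRing R] {d : ℕ} (x : ℕ → R) (ρ : Fin (d+1) → ℕ) (D : Fin d → ℕ)
    (c : ℕ) : ∑ i : Fin (d+1), ((-1) ^ (i : ℕ) * hd x (ρ ∘ i.succAbove) D) * x (ρ i + c) =
      hd x ρ (Fin.cons c D) := by
  rw [hd, Matrix.det_succ_column_zero]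
  refine Finset.sum_congr rfl fun i _ => ?_
  have : (Matrix.of fun i j => x (ρ i + (Fin.cons c D : Fin (d+1) → ℕ) j)).submatrix i.succAbove Fin.succ
      = Matrix.of fun i' j => x ((ρ ∘ i.succAbove) i' + D j) := by
    ext i' j
    simp
  rw [this, hd]
  simp only [Matrix.of_apply, Fin.cons_zero]
  ring

theorem neg_one_cancel {R : Type*} [CommRing R] (k : ℕ) {a b : R}
    (h : (-1) ^ k * a = (-1) ^ k * b) : a = b := by
  have : ((-1 : R) ^ k) * (-1) ^ k = 1 := by
    rw [← mul_pow]; simp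
  calc a = ((-1 : R) ^ k) * ((-1) ^ k * a) := by rw [← mul_assoc, this, one_mul]
    _ = b := by rw [h, ← mul_assoc, this, one_mul]

theorem plucker {R : Type*} [CommRing R] {d : ℕ} (x : ℕ → R) (ρ : Fin (d+1) → ℕ) (D : Fin d → ℕ)
    (E : Fin (d+1) → ℕ) (h : ∀ j : Fin d, hd x ρ (Fin.cons (E j.succ) D) = 0) (k : Fin (d+1)) :
    hd x (ρ ∘ k.succAbove) D * hd x ρ E =
      hd x ρ (Fin.cons (E 0) D) * hd x (ρ ∘ k.succAbove) (fun j => E j.succ) := by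
  have := lin_adj (Matrix.of fun i j => x (ρ i + E j))
    (fun i => (-1) ^ (i : ℕ) * hd x (ρ ∘ i.succAbove) D) _ (cof_sum x ρ D (E 0))
    (fun j => by rw [← h j]; exact cof_sum x ρ D (E j.succ)) k
  rw [Matrix.adjugate_fin_succ_eq_det_submatrix] at this
  apply neg_one_cancel k.1
  have e1 : ((Matrix.of fun i j => x (ρ i + E j)).submatrix k.succAbove (Fin.succAbove 0)).det =
    hd x (ρ ∘ k.succAbove) (fun j => E j.succ) := rfl
  rw [e1] at this
  simp only [Fin.val_zero, add_zero] at this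
  rw [← mul_assoc]
  refine this.trans ?_
  ring

theorem exch {R : Type*} [CommRing R] {d : ℕ} (x : ℕ → R) (ρ : Fin (d+1) → ℕ) (C D : Fin d → ℕ)
    (h : ∀ j : Fin d, hd x ρ (Fin.cons (D j) C) = 0) (i k : Fin (d+1)) :
    hd x (ρ ∘ i.succAbove) C * hd x (ρ ∘ k.succAbove) D =
      hd x (ρ ∘ k.succAbove) C * hd x (ρ ∘ i.succAbove) D := by
  set M : Matrix (Fin (d+1)) (Fin (d+1)) R := Matrix.of fun i' j =>
    (Fin.cons (if i' = k then 1 else 0) (fun j => x (ρ i' + D j)) : Fin (d+1) → R) j with hM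
  have hsub : ∀ i : Fin (d+1), (M.submatrix i.succAbove Fin.succ).det = hd x (ρ ∘ i.succAbove) D := by
    intro i
    rw [hd]
    congr 1
  have hdet : M.det = (-1) ^ (k : ℕ) * hd x (ρ ∘ k.succAbove) D := by
    rw [Matrix.det_succ_column_zero, Finset.sum_eq_single k]
    · rw [hsub]
      simp [hM]
    · intro b _ hb
      simp [hM, hb]
    · simp
  have := lin_adj M (fun i => (-1) ^ (i : ℕ) * hd x (ρ ∘ i.succAbove) C)
    ((-1) ^ (k : ℕ) * hd x (ρ ∘ k.succAbove) C) (by simp [hM])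
    (fun j => by
      rw [← h j, ← cof_sum x ρ C (D j)]
      refine Finset.sum_congr rfl fun i _ => ?_
      simp [hM]) i
  rw [Matrix.adjugate_fin_succ_eq_det_submatrix, hdet, show (Fin.succAbove (0 : Fin (d+1))) = Fin.succ from
    Fin.succAbove_zero, hsub] at this
  simp only [Fin.val_zero, add_zero] at this
  apply neg_one_cancel i.1
  apply neg_one_cancel k.1
  linear_combination this

/-! ### The ideals -/

/-- Ideal of `t`-minors of the Hankel matrix with `t` rows on the variables in `[a,b)`. -/
noncomputable def JJ (n : ℕ) (K : Type*) [Field K] (a b t : ℕ) : Ideal (MvPolynomial (Fin n) K) :=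
  Ideal.span {p | ∃ γ : Fin t → ℕ, StrictMono γ ∧ (∀ j, a + t + γ j < b + 1) ∧
    p = hd (xv n K) (fun i => a + i.1) γ}

theorem add_val_strictMono (a t : ℕ) : StrictMono (fun i : Fin t => a + i.1) := by
  intro i j h
  have : i.1 < j.1 := h
  show a + i.1 < a + j.1
  omega

theorem JJ_eq_NN {n : ℕ} {K : Type*} [Field K] {a b d : ℕ} (hb : b ≤ n) :
    JJ n K a b (d+1) = NN n K a b d := by
  apply span_eq_NN hb
  · rintro p ⟨γ, hγ, h1, rfl⟩
    refine ⟨_, γ, add_val_strictMono a _, hγ, by simp, ?_, rfl⟩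
    have := h1 (Fin.last d)
    simp only [Fin.val_last]
    omega
  · intro c hc1 hc2
    have h0 : ∀ k : Fin (d+1), a + 2 * k.1 ≤ c k := fun k => by
      have h1 := hc2 0 k (Fin.zero_le _)
      have h2 := hc1 0
      simp only [Fin.val_zero] at h1
      omega
    have hmono : StrictMono (fun k : Fin (d+1) => c k - a - k.1) := by
      intro k l hkl
      have h1 := hc2 k l hkl.le
      have h2 : k.1 < l.1 := hkl
      have h3 := h0 k
      have h4 := h0 l
      show c k - a - k.1 < c l - a - l.1
      omega
    refine ⟨fun i => a + i.1, fun k => c k - a - k.1, add_val_strictMono a _, hmono, ?_, ?_⟩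
    · intro k
      have := h0 k
      show a + k.1 + (c k - a - k.1) = c k
      omega
    · refine ⟨_, hmono, ?_, rfl⟩
      intro k
      have h1 := hc2 k (Fin.last d) (Fin.le_last _)
      have h2 := hc1 (Fin.last d)
      have h3 := h0 k
      have h4 := k.2
      simp only [Fin.val_last] at h1
      omega

theorem JJ_prime {n : ℕ} {K : Type*} [Field K] {a b t : ℕ} (hb : b ≤ n) (ht : 1 ≤ t) :
    (JJ n K a b t).IsPrime := by
  obtain ⟨d, rfl⟩ : ∃ d, t = d + 1 := ⟨t - 1, by omega⟩
  rw [JJ_eq_NN hb]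
  exact NN_prime _ _ _ _ _

theorem JJ_zero {n : ℕ} {K : Type*} [Field K] {a b : ℕ} : JJ n K a b 0 = ⊤ := by
  rw [Ideal.eq_top_iff_one]
  apply Ideal.subset_span
  refine ⟨Fin.elim0, fun i => i.elim0, fun i => i.elim0, ?_⟩
  rw [hd, Matrix.det_isEmpty]

theorem hd_mem_JJ {n : ℕ} {K : Type*} [Field K] {a b t : ℕ} (hb : b ≤ n) (ρ γ : Fin t → ℕ)
    (h : ∀ i j, a ≤ ρ i + γ j ∧ ρ i + γ j < b) : hd (xv n K) ρ γ ∈ JJ n K a b t := by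
  cases t with
  | zero => rw [JJ_zero]; trivial
  | succ d => rw [JJ_eq_NN hb]; exact hd_mem_NN hb _ _ h

theorem JJ_mono {n : ℕ} {K : Type*} [Field K] {a b a' b' t : ℕ} (hb : b' ≤ n) (h1 : a' ≤ a)
    (h2 : b ≤ b') : JJ n K a b t ≤ JJ n K a' b' t := by
  rw [JJ, Ideal.span_le]
  rintro p ⟨γ, hγ, h3, rfl⟩
  refine hd_mem_JJ hb _ _ fun i j => ?_
  have := h3 j
  have := i.2
  omega

theorem JJ_low {n : ℕ} {K : Type*} [Field K] {a b t : ℕ} (hb : b ≤ n) :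
    JJ n K a (b+1) (t+1) ≤ JJ n K a b t := by
  rw [JJ, Ideal.span_le]
  rintro p ⟨γ, hγ, h3, rfl⟩
  rw [hd, Matrix.det_succ_row _ (Fin.last t)]
  refine Ideal.sum_mem _ fun j _ => Ideal.mul_mem_left _ _ ?_
  refine hd_mem_JJ hb (fun i => a + ((Fin.last t).succAbove i).1) (fun k => γ (j.succAbove k))
    fun i k => ?_
  have := h3 (j.succAbove k)
  have := i.2
  simp only [Fin.succAbove_last, Fin.val_castSucc]
  omega

theorem JJ_high {n : ℕ} {K : Type*} [Field K] {a b t : ℕ} (hb : b ≤ n) :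
    JJ n K a b (t+1) ≤ JJ n K (a+1) b t := by
  rw [JJ, Ideal.span_le]
  rintro p ⟨γ, hγ, h3, rfl⟩
  rw [hd, Matrix.det_succ_row _ 0]
  refine Ideal.sum_mem _ fun j _ => Ideal.mul_mem_left _ _ ?_
  refine hd_mem_JJ hb (fun i => a + ((0 : Fin (t+1)).succAbove i).1) (fun k => γ (j.succAbove k))
    fun i k => ?_
  have := h3 (j.succAbove k)
  have := i.2
  simp only [Fin.succAbove_zero, Fin.val_succ]
  omega

/-! ### Non-membership -/

/-- Degree in the variables in `[a,b)`. -/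
noncomputable def wt (n a b : ℕ) : (Fin n →₀ ℕ) →+ ℕ :=
  Finsupp.weight (fun j : Fin n => if a ≤ j.1 ∧ j.1 < b then 1 else 0)

theorem wt_expo {n a b t : ℕ} (c : Fin t → ℕ) (hc : ∀ k, c k < n) :
    wt n a b (expo n c) = (Finset.univ.filter fun k => a ≤ c k ∧ c k < b).card := by
  rw [expo, map_sum, Finset.card_filter]
  refine Finset.sum_congr rfl fun k _ => ?_
  simp [dif_pos (hc k), wt, Finsupp.weight_apply]

/-- Polynomials all of whose monomials have degree at least `t` in the variables in `[a,b)`. -/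
noncomputable def WI (n : ℕ) (K : Type*) [Field K] (a b t : ℕ) : Ideal (MvPolynomial (Fin n) K) where
  carrier := {p | ∀ m ∈ p.support, t ≤ wt n a b m}
  zero_mem' := by simp
  add_mem' := by
    classical
    intro p q hp hq m hm
    rcases Finset.mem_union.1 (support_add hm) with h | h
    · exact hp m h
    · exact hq m h
  smul_mem' := by
    classical
    intro p q hq m hm
    obtain ⟨m1, h1, m2, h2, rfl⟩ := Finset.mem_add.1 (support_mul p q hm)
    rw [map_add]
    exact le_trans (hq m2 h2) (Nat.le_add_left _ _)

theorem JJ_le_WI {n : ℕ} {K : Type*} [Field K] {a b t : ℕ} (hb : b ≤ n) :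
    JJ n K a b t ≤ WI n K a b t := by
  classical
  rw [JJ, Ideal.span_le]
  rintro p ⟨γ, hγ, h3, rfl⟩
  have hidx : ∀ i j : Fin t, a + i.1 + γ j < b := fun i j => by
    have := h3 j
    have := i.2
    omega
  intro m hm
  rw [hd_eq_sum _ _ (fun i j => lt_of_lt_of_le (hidx i j) hb)] at hm
  obtain ⟨σ, -, hσ⟩ := Finset.mem_biUnion.1 (support_sum hm)
  rw [Finset.mem_singleton.1 (support_monomial_subset hσ),
    wt_expo _ (fun k => lt_of_lt_of_le (hidx _ _) hb), Finset.filter_true_of_mem]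
  · simp
  · intro k _
    have := hidx (σ k) k
    omega

theorem hd_not_mem {n : ℕ} {K : Type*} [Field K] {a b t T : ℕ} (hb : b ≤ n) (ρ γ : Fin T → ℕ)
    (hρ : StrictMono ρ) (hγ : StrictMono γ) (h : ∀ i j, ρ i + γ j < n)
    (hcard : (Finset.univ.filter fun k => a ≤ ρ k + γ k ∧ ρ k + γ k < b).card < t) :
    hd (xv n K) ρ γ ∉ JJ n K a b t := by
  intro hmem
  have := JJ_le_WI hb hmem (expo n (fun k => ρ k + γ k)) (by
    rw [mem_support_iff, hd_coeff ρ γ hρ hγ h]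
    exact one_ne_zero)
  rw [wt_expo _ (fun k => h k k)] at this
  omega

end HK
namespace HK

/-! ### Knutson family steps -/

theorem kf_top {σ K : Type*} [CommRing K] {f : MvPolynomial σ K} {I : Ideal (MvPolynomial σ K)}
    (h : KnutsonFamily f I) : KnutsonFamily f ⊤ := by
  have := KnutsonFamily.colon I ⊥ h
  rwa [Submodule.colon_bot] at this

theorem kf_prime {σ K : Type*} [CommRing K] {f : MvPolynomial σ K} {I J : Ideal (MvPolynomial σ K)}
    (h : KnutsonFamily f I) (hJ : J.IsPrime) (hle : I ≤ J) (δ : MvPolynomial σ K) (hδ : δ ∉ J)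
    (hm : ∀ p ∈ J, p * δ ∈ I) : KnutsonFamily f J := by
  have e : I.colon (Ideal.span {δ} : Ideal (MvPolynomial σ K)) = J := by
    ext p
    rw [Ideal.mem_colon_span_singleton]
    constructor
    · intro hp
      exact (hJ.mem_or_mem (hle hp)).resolve_right hδ
    · exact hm p
  have := KnutsonFamily.colon I (Ideal.span {δ}) h
  rwa [e] at this

theorem JJ_mul {n : ℕ} {K : Type*} [Field K] {a b t : ℕ} {I : Ideal (MvPolynomial (Fin n) K)}
    {δ : MvPolynomial (Fin n) K}
    (h : ∀ γ : Fin t → ℕ, StrictMono γ → (∀ j, a + t + γ j < b + 1) →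
      hd (xv n K) (fun i => a + i.1) γ * δ ∈ I) :
    ∀ p ∈ JJ n K a b t, p * δ ∈ I := by
  have : JJ n K a b t ≤ I.colon (Ideal.span {δ} : Ideal (MvPolynomial (Fin n) K)) := by
    rw [JJ, Ideal.span_le]
    rintro p ⟨γ, h1, h2, rfl⟩
    exact Ideal.mem_colon_span_singleton.2 (h γ h1 h2)
  intro p hp
  exact Ideal.mem_colon_span_singleton.1 (this hp)

theorem exch_mem {R : Type*} [CommRing R] {d : ℕ} (I : Ideal R) (x : ℕ → R) (ρ : Fin (d+1) → ℕ)
    (C D : Fin d → ℕ) (h : ∀ j : Fin d, hd x ρ (Fin.cons (D j) C) ∈ I) (i k : Fin (d+1)) :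
    hd x (ρ ∘ i.succAbove) C * hd x (ρ ∘ k.succAbove) D -
      hd x (ρ ∘ k.succAbove) C * hd x (ρ ∘ i.succAbove) D ∈ I := by
  rw [← Ideal.Quotient.eq_zero_iff_mem, map_sub, map_mul, map_mul, hd_map, hd_map, hd_map, hd_map,
    sub_eq_zero]
  apply exch
  intro j
  rw [← hd_map, Ideal.Quotient.eq_zero_iff_mem]
  exact h j

theorem plucker_mem {R : Type*} [CommRing R] {d : ℕ} (I : Ideal R) (x : ℕ → R) (ρ : Fin (d+1) → ℕ)
    (D : Fin d → ℕ) (E : Fin (d+1) → ℕ) (h : ∀ j : Fin d, hd x ρ (Fin.cons (E j.succ) D) ∈ I)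
    (k : Fin (d+1)) :
    hd x (ρ ∘ k.succAbove) D * hd x ρ E -
      hd x ρ (Fin.cons (E 0) D) * hd x (ρ ∘ k.succAbove) (fun j => E j.succ) ∈ I := by
  rw [← Ideal.Quotient.eq_zero_iff_mem, map_sub, map_mul, map_mul, hd_map, hd_map, hd_map, hd_map,
    sub_eq_zero]
  apply plucker
  intro j
  rw [← hd_map, Ideal.Quotient.eq_zero_iff_mem]
  exact h j

theorem hd_congr {R : Type*} [CommRing R] (x : ℕ → R) {t : ℕ} {ρ γ ρ' γ' : Fin t → ℕ}
    (h : ∀ i j, ρ i + γ j = ρ' i + γ' j) : hd x ρ γ = hd x ρ' γ' := by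
  simp only [hd, h]

theorem card_filter_lt {t : ℕ} (P : Fin t → Prop) [DecidablePred P] (k : Fin t) (hk : ¬ P k) :
    (Finset.univ.filter P).card < t := by
  have : (Finset.univ.filter P) ⊂ Finset.univ := by
    rw [Finset.filter_ssubset]
    exact ⟨k, Finset.mem_univ _, hk⟩
  simpa using Finset.card_lt_card this

theorem stepA_L {N t : ℕ} {K : Type*} [Field K] (ht : 1 ≤ t) (hN : 2 * t ≤ N)
    {f : MvPolynomial (Fin (N+1)) K} (hP : KnutsonFamily f (JJ (N+1) K 0 (N+1) (t+1)))
    (hQ : KnutsonFamily f (JJ (N+1) K 1 N t)) : KnutsonFamily f (JJ (N+1) K 0 N t) := by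
  refine kf_prime (KnutsonFamily.add _ _ hP hQ) (JJ_prime (by omega) ht)
    (sup_le (JJ_low (by omega)) (JJ_mono (by omega) (by omega) (by omega)))
    (hd (xv (N+1) K) (fun i : Fin t => 1 + i.1) (fun j => (N + 1 - 2 * t) + j.1))
    (hd_not_mem (by omega) _ _ (add_val_strictMono _ _) (add_val_strictMono _ _) ?_ ?_)
    (JJ_mul fun γ hγ hb => ?_)
  · intro i j
    have := i.2
    have := j.2
    omega
  · apply card_filter_lt _ ⟨t-1, by omega⟩
    simp only
    omega
  · have key := exch_mem (JJ (N+1) K 0 (N+1) (t+1) + JJ (N+1) K 1 N t) (xv (N+1) K)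
      (fun i : Fin (t+1) => i.1) γ (fun j => (N + 1 - 2 * t) + j.1) (fun j => by
        refine Ideal.mem_sup_left (hd_mem_JJ le_rfl _ _ fun i k => ?_)
        have := i.2
        refine Fin.cases ?_ (fun k => ?_) k
        · simp only [Fin.cons_zero]
          have := j.2
          omega
        · simp only [Fin.cons_succ]
          have := hb k
          omega) (Fin.last t) 0
    have e1 : hd (xv (N+1) K) ((fun i : Fin (t+1) => i.1) ∘ (Fin.last t).succAbove) γ =
        hd (xv (N+1) K) (fun i => 0 + i.1) γ := hd_congr _ fun i j => by simp
    have e2 : hd (xv (N+1) K) ((fun i : Fin (t+1) => i.1) ∘ (0 : Fin (t+1)).succAbove)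
        (fun j : Fin t => (N + 1 - 2 * t) + j.1) =
        hd (xv (N+1) K) (fun i : Fin t => 1 + i.1) (fun j => (N + 1 - 2 * t) + j.1) :=
      hd_congr _ fun i j => by simp; omega
    rw [e1, e2] at key
    refine (Submodule.sub_mem_iff_left _ ?_).1 key
    refine Ideal.mul_mem_left _ _ (Ideal.mem_sup_right (hd_mem_JJ (by omega) _ _ fun i k => ?_))
    simp only [Function.comp, Fin.succAbove_last, Fin.val_castSucc]
    have := i.2
    have := k.2
    omega

theorem stepA_R {N t : ℕ} {K : Type*} [Field K] (ht : 1 ≤ t) (hN : 2 * t ≤ N)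
    {f : MvPolynomial (Fin (N+1)) K} (hP : KnutsonFamily f (JJ (N+1) K 0 (N+1) (t+1)))
    (hQ : KnutsonFamily f (JJ (N+1) K 1 N t)) : KnutsonFamily f (JJ (N+1) K 1 (N+1) t) := by
  refine kf_prime (KnutsonFamily.add _ _ hP hQ) (JJ_prime (by omega) ht)
    (sup_le (JJ_high (by omega)) (JJ_mono (by omega) (by omega) (by omega)))
    (hd (xv (N+1) K) (fun i : Fin t => 0 + i.1) (fun j => 0 + j.1))
    (hd_not_mem (by omega) _ _ (add_val_strictMono _ _) (add_val_strictMono _ _) ?_ ?_)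
    (JJ_mul fun γ hγ hb => ?_)
  · intro i j
    have := i.2
    have := j.2
    omega
  · apply card_filter_lt _ ⟨0, by omega⟩
    simp
  · have key := exch_mem (JJ (N+1) K 0 (N+1) (t+1) + JJ (N+1) K 1 N t) (xv (N+1) K)
      (fun i : Fin (t+1) => i.1) γ (fun j => 0 + j.1) (fun j => by
        refine Ideal.mem_sup_left (hd_mem_JJ le_rfl _ _ fun i k => ?_)
        have := i.2
        refine Fin.cases ?_ (fun k => ?_) k
        · simp only [Fin.cons_zero]
          have := j.2
          omega
        · simp only [Fin.cons_succ]
          have := hb k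
          omega) 0 (Fin.last t)
    have e1 : hd (xv (N+1) K) ((fun i : Fin (t+1) => i.1) ∘ (0 : Fin (t+1)).succAbove) γ =
        hd (xv (N+1) K) (fun i => 1 + i.1) γ := hd_congr _ fun i j => by simp; omega
    have e2 : hd (xv (N+1) K) ((fun i : Fin (t+1) => i.1) ∘ (Fin.last t).succAbove)
        (fun j : Fin t => 0 + j.1) =
        hd (xv (N+1) K) (fun i : Fin t => 0 + i.1) (fun j => 0 + j.1) :=
      hd_congr _ fun i j => by simp
    rw [e1, e2] at key
    refine (Submodule.sub_mem_iff_left _ ?_).1 key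
    refine Ideal.mul_mem_left _ _ (Ideal.mem_sup_right (hd_mem_JJ (by omega) _ _ fun i k => ?_))
    simp only [Function.comp, Fin.succAbove_zero, Fin.val_succ]
    have := i.2
    have := k.2
    omega

/-- The auxiliary `d`-minor used in step B. -/
noncomputable def sB (N : ℕ) (K : Type*) [Field K] (d : ℕ) : MvPolynomial (Fin (N+1)) K :=
  hd (xv (N+1) K) (fun i : Fin d => 0 + i.1) (fun j => (N + 1 - 2 * d) + j.1)

theorem sB_mul {N d : ℕ} {K : Type*} [Field K] (hN : 2 * (d + 1) ≤ N + 1) :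
    ∀ p ∈ JJ (N+1) K 0 (N+1) (d+1),
      p * sB N K d ∈ JJ (N+1) K 0 N (d+1) + JJ (N+1) K 1 (N+1) (d+1) := by
  refine JJ_mul fun γ hγ hb => ?_
  have hc : ∀ c, c ≤ N - d → hd (xv (N+1) K) (fun i : Fin (d+1) => 0 + i.1)
      (Fin.cons c (fun j : Fin d => (N - 2 * d) + j.1)) ∈
        JJ (N+1) K 0 N (d+1) + JJ (N+1) K 1 (N+1) (d+1) := by
    intro c hc
    rcases Nat.lt_or_ge c (N - d) with h | h
    · refine Ideal.mem_sup_left (hd_mem_JJ (by omega) _ _ fun i k => ?_)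
      have := i.2
      refine Fin.cases ?_ (fun k => ?_) k
      · simp only [Fin.cons_zero]
        omega
      · simp only [Fin.cons_succ]
        have := k.2
        omega
    · refine Ideal.mem_sup_right (hd_mem_JJ (by omega) _ _ fun i k => ?_)
      have := i.2
      refine Fin.cases ?_ (fun k => ?_) k
      · simp only [Fin.cons_zero]
        omega
      · simp only [Fin.cons_succ]
        have := k.2
        omega
  have hγb : ∀ j, γ j ≤ N - d := fun j => by
    have := hb j
    omega
  have key := plucker_mem (JJ (N+1) K 0 N (d+1) + JJ (N+1) K 1 (N+1) (d+1)) (xv (N+1) K)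
    (fun i : Fin (d+1) => 0 + i.1) (fun j : Fin d => (N - 2 * d) + j.1) γ
    (fun j => hc _ (hγb _)) 0
  have e1 : hd (xv (N+1) K) ((fun i : Fin (d+1) => 0 + i.1) ∘ (0 : Fin (d+1)).succAbove)
      (fun j : Fin d => (N - 2 * d) + j.1) = sB N K d :=
    hd_congr _ fun i j => by simp; omega
  rw [e1] at key
  rw [mul_comm]
  exact (Submodule.sub_mem_iff_left _ (Ideal.mul_mem_right _ _ (hc _ (hγb _)))).1 key

theorem stepB_P {N d : ℕ} {K : Type*} [Field K] (hN : 2 * (d + 1) ≤ N + 1)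
    {f : MvPolynomial (Fin (N+1)) K} (hL : KnutsonFamily f (JJ (N+1) K 0 N (d+1)))
    (hR : KnutsonFamily f (JJ (N+1) K 1 (N+1) (d+1))) :
    KnutsonFamily f (JJ (N+1) K 0 (N+1) (d+1)) := by
  refine kf_prime (KnutsonFamily.add _ _ hL hR) (JJ_prime (by omega) (by omega))
    (sup_le (JJ_mono (by omega) (by omega) (by omega)) (JJ_mono (by omega) (by omega) (by omega)))
    (sB N K d)
    (hd_not_mem (by omega) _ _ (add_val_strictMono _ _) (add_val_strictMono _ _) ?_ ?_)
    (sB_mul hN)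
  · intro i j
    have := i.2
    have := j.2
    omega
  · refine lt_of_le_of_lt (Finset.card_filter_le _ _) ?_
    simp

theorem stepB_Q {N d : ℕ} {K : Type*} [Field K] (hN : 2 * (d + 1) ≤ N + 1)
    {f : MvPolynomial (Fin (N+1)) K} (hL : KnutsonFamily f (JJ (N+1) K 0 N (d+1)))
    (hR : KnutsonFamily f (JJ (N+1) K 1 (N+1) (d+1))) :
    KnutsonFamily f (JJ (N+1) K 1 N d) := by
  rcases Nat.eq_zero_or_pos d with rfl | hd0
  · rw [JJ_zero]
    exact kf_top hL
  refine kf_prime (KnutsonFamily.add _ _ hL hR) (JJ_prime (by omega) (by omega))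
    (sup_le (JJ_high (by omega)) (JJ_low (by omega)))
    (hd (xv (N+1) K) (fun i : Fin (d+1) => 0 + i.1)
      (Fin.cons 0 (fun j : Fin d => (N + 1 - 2 * d) + j.1)))
    (hd_not_mem (by omega) _ _ (add_val_strictMono _ _) ?_ ?_ ?_)
    (JJ_mul fun γ hγ hb => ?_)
  · intro i
    refine Fin.cases ?_ (fun i => ?_) i
    · intro j
      refine Fin.cases ?_ (fun j => ?_) j
      · intro h
        exact absurd h (lt_irrefl _)
      · intro h
        simp only [Fin.cons_zero, Fin.cons_succ]
        omega
    · intro j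
      refine Fin.cases ?_ (fun j => ?_) j
      · intro h
        exact absurd h (by simp)
      · intro h
        have : i.1 < j.1 := by simpa using h
        simp only [Fin.cons_succ]
        omega
  · intro i j
    have := i.2
    refine Fin.cases ?_ (fun j => ?_) j
    · simp only [Fin.cons_zero]
      omega
    · simp only [Fin.cons_succ]
      have := j.2
      omega
  · refine lt_of_le_of_lt (Finset.card_le_card (t := (Finset.univ.erase 0).erase (Fin.last d)) ?_) ?_
    · intro k hk
      rw [Finset.mem_filter] at hk
      rw [Finset.mem_erase, Finset.mem_erase]
      refine ⟨?_, ?_, Finset.mem_univ _⟩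
      · rintro rfl
        obtain ⟨e, rfl⟩ : ∃ e, d = e + 1 := ⟨d - 1, by omega⟩
        have h2 := hk.2
        rw [← Fin.succ_last] at h2
        simp only [Fin.cons_succ, Fin.val_succ, Fin.val_last] at h2
        omega
      · rintro rfl
        simpa using hk.2
    · rw [Finset.card_erase_of_mem, Finset.card_erase_of_mem (Finset.mem_univ _), Finset.card_univ,
        Fintype.card_fin]
      · omega
      · rw [Finset.mem_erase]
        refine ⟨?_, Finset.mem_univ _⟩
        intro h
        have := congrArg Fin.val h
        simp at this
        omega
  · have key := plucker_mem (JJ (N+1) K 0 N (d+1) + JJ (N+1) K 1 (N+1) (d+1)) (xv (N+1) K)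
      (fun i : Fin (d+1) => 0 + i.1) (fun j : Fin d => γ j + 1)
      (Fin.cons 0 (fun j : Fin d => (N + 1 - 2 * d) + j.1))
      (fun j => by
        refine Ideal.mem_sup_right (hd_mem_JJ (by omega) _ _ fun i k => ?_)
        have := i.2
        refine Fin.cases ?_ (fun k => ?_) k
        · simp only [Fin.cons_zero, Fin.cons_succ]
          have := j.2
          omega
        · simp only [Fin.cons_succ]
          have := hb k
          omega) (Fin.last d)
    have e1 : hd (xv (N+1) K) ((fun i : Fin (d+1) => 0 + i.1) ∘ (Fin.last d).succAbove)
        (fun j : Fin d => γ j + 1) = hd (xv (N+1) K) (fun i : Fin d => 1 + i.1) γ :=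
      hd_congr _ fun i j => by simp; omega
    have e2 : hd (xv (N+1) K) ((fun i : Fin (d+1) => 0 + i.1) ∘ (Fin.last d).succAbove)
        (fun j : Fin d => (Fin.cons 0 (fun j : Fin d => (N + 1 - 2 * d) + j.1) : Fin (d+1) → ℕ) j.succ)
        = sB N K d :=
      hd_congr _ fun i j => by simp
    rw [e1, e2] at key
    refine (Submodule.sub_mem_iff_left _ (sB_mul hN _ ?_)).1 key
    refine hd_mem_JJ (by omega) _ _ fun i k => ?_
    have := i.2
    refine Fin.cases ?_ (fun k => ?_) k
    · simp only [Fin.cons_zero]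
      omega
    · simp only [Fin.cons_succ]
      have := hb k
      omega

theorem descent {N m : ℕ} {K : Type*} [Field K] (hm : 2 * m ≤ N)
    {f : MvPolynomial (Fin (N+1)) K} (hP : KnutsonFamily f (JJ (N+1) K 0 (N+1) (m+1)))
    (hQ : KnutsonFamily f (JJ (N+1) K 1 N m)) :
    ∀ d, d ≤ m → KnutsonFamily f (JJ (N+1) K 0 (N+1) (d+1)) := by
  induction m with
  | zero =>
    intro d hd
    obtain rfl : d = 0 := by omega
    exact hP
  | succ m ih =>
    intro d hd
    rcases Nat.lt_or_ge m d with h | h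
    · obtain rfl : d = m + 1 := by omega
      exact hP
    · have hL := stepA_L (by omega) (by omega) hP hQ
      have hR := stepA_R (by omega) (by omega) hP hQ
      exact ih (by omega) (stepB_P (by omega) hL hR) (stepB_Q (by omega) hL hR) d h

theorem JJ_principal {n a b t : ℕ} {K : Type*} [Field K] (h : b + 1 = a + 2 * t) :
    JJ n K a b t = Ideal.span {hd (xv n K) (fun i : Fin t => a + i.1) (fun j => 0 + j.1)} := by
  rw [JJ]
  congr 1
  ext p
  rw [Set.mem_singleton_iff]
  constructor
  · rintro ⟨γ, hγ, hb, rfl⟩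
    have hlt : ∀ j, γ j < t := fun j => by
      have := hb j
      omega
    have hg : StrictMono (fun j => (⟨γ j, hlt j⟩ : Fin t)) := fun i j hij => hγ hij
    refine hd_congr _ fun i j => ?_
    have h1 : j.1 ≤ γ j := hg.le_apply
    have h2 : γ j ≤ j.1 := hg.apply_le
    omega
  · rintro rfl
    refine ⟨_, add_val_strictMono 0 t, fun j => ?_, rfl⟩
    have := j.2
    omega

theorem colon_span_mul {R : Type*} [CommRing R] [IsDomain R] (g h : R) (hh : h ≠ 0) :
    (Ideal.span {g * h} : Ideal R).colon (Ideal.span {h} : Ideal R) = Ideal.span {g} := by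
  ext p
  rw [Ideal.mem_colon_span_singleton, Ideal.mem_span_singleton, Ideal.mem_span_singleton,
    mul_dvd_mul_iff_right hh]

/-- The polynomial `f`. -/
noncomputable def FF (N : ℕ) (K : Type*) [Field K] : MvPolynomial (Fin (N+1)) K :=
  hd (xv (N+1) K) (fun i : Fin (N/2+1) => 0 + i.1) (fun j => 0 + j.1) *
  hd (xv (N+1) K) (fun i : Fin ((N+1)/2) => 1 + i.1) (fun j => 0 + j.1)

theorem bd1 (N : ℕ) (i j : Fin (N/2+1)) : 0 + i.1 + (0 + j.1) < N + 1 := by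
  have := i.2
  have := j.2
  omega

theorem bd2 (N : ℕ) (i j : Fin ((N+1)/2)) : 1 + i.1 + (0 + j.1) < N + 1 := by
  have := i.2
  have := j.2
  omega

theorem hd_ne_zero {n t : ℕ} {K : Type*} [Field K] (ρ γ : Fin t → ℕ) (hρ : StrictMono ρ)
    (hγ : StrictMono γ) (h : ∀ i j, ρ i + γ j < n) : hd (xv n K) ρ γ ≠ 0 := by
  intro e
  have := hd_coeff (K := K) ρ γ hρ hγ h
  rw [e, coeff_zero] at this
  exact zero_ne_one this

theorem F1_ne (N : ℕ) (K : Type*) [Field K] :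
    hd (xv (N+1) K) (fun i : Fin (N/2+1) => 0 + i.1) (fun j => 0 + j.1) ≠ 0 :=
  hd_ne_zero _ _ (add_val_strictMono _ _) (add_val_strictMono _ _) (bd1 N)

theorem F2_ne (N : ℕ) (K : Type*) [Field K] :
    hd (xv (N+1) K) (fun i : Fin ((N+1)/2) => 1 + i.1) (fun j => 0 + j.1) ≠ 0 :=
  hd_ne_zero _ _ (add_val_strictMono _ _) (add_val_strictMono _ _) (bd2 N)

theorem FF_sqfree (N : ℕ) (K : Type*) [Field K] :
    MonomialOrder.lex.HasSqfreeLeadTerm (FF N K) := by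
  refine ⟨mul_ne_zero (F1_ne N K) (F2_ne N K), fun i => ?_⟩
  show MonomialOrder.lex.degree (FF N K) i ≤ 1
  rw [FF, MonomialOrder.degree_mul (F1_ne N K) (F2_ne N K),
    hd_degree _ _ (add_val_strictMono _ _) (add_val_strictMono _ _) (bd1 N),
    hd_degree _ _ (add_val_strictMono _ _) (add_val_strictMono _ _) (bd2 N), Finsupp.add_apply,
    expo_apply, expo_apply]
  rcases Nat.even_or_odd' i.1 with ⟨k, hk | hk⟩
  · have he : (Finset.univ.filter fun j : Fin ((N+1)/2) => 1 + j.1 + (0 + j.1) = i.1) = ∅ :=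
      Finset.filter_eq_empty_iff.2 fun j _ => by omega
    rw [he, Finset.card_empty, add_zero, Finset.card_le_one]
    intro a ha b hb
    simp only [Finset.mem_filter] at ha hb
    apply Fin.ext
    omega
  · have he : (Finset.univ.filter fun j : Fin (N/2+1) => 0 + j.1 + (0 + j.1) = i.1) = ∅ :=
      Finset.filter_eq_empty_iff.2 fun j _ => by omega
    rw [he, Finset.card_empty, zero_add, Finset.card_le_one]
    intro a ha b hb
    simp only [Finset.mem_filter] at ha hb
    apply Fin.ext
    omega

theorem FF_mem (N : ℕ) (K : Type*) [Field K] (d : ℕ) (hd : d ≤ N / 2) :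
    KnutsonFamily (FF N K) (JJ (N+1) K 0 (N+1) (d+1)) := by
  have h0 := KnutsonFamily.base (f := FF N K)
  have h1 := KnutsonFamily.colon _ (Ideal.span
    {HK.hd (xv (N+1) K) (fun i : Fin ((N+1)/2) => 1 + i.1) (fun j => 0 + j.1)}) h0
  have h2 := KnutsonFamily.colon _ (Ideal.span
    {HK.hd (xv (N+1) K) (fun i : Fin (N/2+1) => 0 + i.1) (fun j => 0 + j.1)}) h0
  nth_rw 2 [FF] at h1
  nth_rw 2 [FF] at h2
  rw [colon_span_mul _ _ (F2_ne N K)] at h1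
  rw [mul_comm, colon_span_mul _ _ (F1_ne N K)] at h2
  rcases Nat.even_or_odd' N with ⟨m, hm | hm⟩
  · have e1 : N / 2 + 1 = m + 1 := by omega
    have e2 : (N + 1) / 2 = m := by omega
    rw [← JJ_principal (b := N + 1) (by omega), e1] at h1
    rw [← JJ_principal (b := N) (by omega), e2] at h2
    exact descent (by omega) h1 h2 d (by omega)
  · have e1 : N / 2 + 1 = m + 1 := by omega
    have e2 : (N + 1) / 2 = m + 1 := by omega
    rw [← JJ_principal (b := N) (by omega), e1] at h1
    rw [← JJ_principal (b := N + 1) (by omega), e2] at h2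
    exact descent (m := m) (by omega) (stepB_P (by omega) h1 h2) (stepB_Q (by omega) h1 h2) d
      (by omega)

theorem minors_eq {K : Type*} [Field K] (r s d : ℕ) (h1 : d + 1 ≤ r) (h2 : d + 1 ≤ s) :
    minorsIdeal (d+1) (hankelGen K r s) = JJ (r + s - 1) K 0 (r + s - 1) (d+1) := by
  have hsub : ∀ (ρ : Fin (d+1) → Fin r) (γ : Fin (d+1) → Fin s),
      ((hankelGen K r s).submatrix ρ γ).det =
        hd (xv (r + s - 1) K) (fun i => (ρ i).1) (fun j => (γ j).1) := by
    intro ρ γ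
    rw [hd]
    congr 1
    ext1 i j
    have : (ρ i).1 + (γ j).1 < r + s - 1 := by
      have := (ρ i).2
      have := (γ j).2
      omega
    simp only [Matrix.submatrix_apply, hankelGen, Matrix.of_apply, xv, dif_pos this]
  rw [JJ_eq_NN le_rfl, minorsIdeal]
  apply span_eq_NN le_rfl
  · rintro p ⟨ρ, γ, hρ, hγ, rfl⟩
    refine ⟨fun i => (ρ i).1, fun j => (γ j).1, fun i j h => hρ h, fun i j h => hγ h, by omega, ?_,
      hsub _ _⟩
    have := (ρ (Fin.last d)).2
    have := (γ (Fin.last d)).2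
    simp only
    omega
  · intro c hc1 hc2
    have ha : ∀ k : Fin (d+1), 2 * k.1 ≤ c k := fun k => by
      have h1 := hc2 0 k (Fin.zero_le _)
      simp only [Fin.val_zero] at h1
      omega
    have hb : ∀ k : Fin (d+1), c k + 2 * d < r + s - 1 + 2 * k.1 := fun k => by
      have h1 := hc2 k (Fin.last d) (Fin.le_last _)
      have h2 := (hc1 (Fin.last d)).2
      simp only [Fin.val_last] at h1
      omega
    have hρ : StrictMono (fun k : Fin (d+1) => max k.1 (c k + d + 1 - k.1 - s)) := by
      intro k l hkl
      have h1 := hc2 k l hkl.le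
      have h2 : k.1 < l.1 := hkl
      have h3 := ha k
      have h4 := l.2
      show max k.1 (c k + d + 1 - k.1 - s) < max l.1 (c l + d + 1 - l.1 - s)
      omega
    have hγ : StrictMono (fun k : Fin (d+1) => c k - max k.1 (c k + d + 1 - k.1 - s)) := by
      intro k l hkl
      have h1 := hc2 k l hkl.le
      have h2 : k.1 < l.1 := hkl
      have h3 := ha k
      have h3' := ha l
      have h4 := l.2
      show c k - max k.1 (c k + d + 1 - k.1 - s) < c l - max l.1 (c l + d + 1 - l.1 - s)
      omega
    refine ⟨_, _, hρ, hγ, ?_, ?_⟩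
    · intro k
      have h3 := ha k
      have h4 := k.2
      show max k.1 (c k + d + 1 - k.1 - s) + (c k - max k.1 (c k + d + 1 - k.1 - s)) = c k
      omega
    · refine ⟨fun k => ⟨max k.1 (c k + d + 1 - k.1 - s), ?_⟩,
        fun k => ⟨c k - max k.1 (c k + d + 1 - k.1 - s), ?_⟩, fun i j h => hρ h, fun i j h => hγ h, ?_⟩
      · have h3 := hb k
        have h4 := k.2
        omega
      · have h3 := ha k
        have h4 := k.2
        omega
      · rw [hsub]

/-- A copy of a monomial order in another universe. -/
noncomputable def liftOrd.{v, u, w} {σ : Type u} (m : MonomialOrder.{u, w} σ) :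
    MonomialOrder.{u, max w v} σ where
  syn := ULift.{v} m.syn
  isOrderedAddMonoid_syn := 
    { add_le_add_left := fun a b h c => add_le_add_left (α := m.syn) h c.down }
  toSyn := m.toSyn.trans AddEquiv.ulift.symm
  toSyn_monotone := fun a b h => m.toSyn_monotone h

theorem liftOrd_sqfree.{v} {σ : Type*} {K : Type*} [Field K] (m : MonomialOrder σ)
    (f : MvPolynomial σ K) (h : m.HasSqfreeLeadTerm f) : (liftOrd.{v} m).HasSqfreeLeadTerm f := by
  refine ⟨h.1, fun i => ?_⟩
  have e : (liftOrd.{v} m).degree f = m.degree f := by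
    apply m.toSyn.injective
    apply le_antisymm
    · exact m.le_degree ((liftOrd.{v} m).degree_mem_support h.1)
    · have := (liftOrd.{v} m).le_degree (m.degree_mem_support h.1)
      exact ULift.down_le.{_, v}.2 this
  show (liftOrd.{v} m).degree f i ≤ 1
  rw [e]
  exact h.2 i

theorem final {K : Type*} [Field K] (r s t : ℕ) (ht : t ≤ min r s) :
    ∃ (ord : MonomialOrder (Fin (r + s - 1))) (f : MvPolynomial (Fin (r + s - 1)) K),
      ord.HasSqfreeLeadTerm f ∧ KnutsonFamily f (minorsIdeal t (hankelGen K r s)) := by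
  cases t with
  | zero =>
    refine ⟨liftOrd MonomialOrder.lex, 1, liftOrd_sqfree _ _ ⟨one_ne_zero, fun i => ?_⟩, ?_⟩
    · show MonomialOrder.lex.degree (1 : MvPolynomial (Fin (r + s - 1)) K) i ≤ 1
      rw [MonomialOrder.degree_one]
      simp
    · have : minorsIdeal 0 (hankelGen K r s) = ⊤ := by
        rw [Ideal.eq_top_iff_one]
        apply Ideal.subset_span
        refine ⟨Fin.elim0, Fin.elim0, fun i => i.elim0, fun i => i.elim0, ?_⟩
        rw [Matrix.det_isEmpty]
      rw [this]
      exact kf_top KnutsonFamily.base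
  | succ d =>
    have h1 : d + 1 ≤ r := le_trans ht (min_le_left _ _)
    have h2 : d + 1 ≤ s := le_trans ht (min_le_right _ _)
    rw [minors_eq r s d h1 h2]
    obtain ⟨N, hN⟩ : ∃ N, r + s - 1 = N + 1 := ⟨r + s - 2, by omega⟩
    rw [hN]
    exact ⟨liftOrd MonomialOrder.lex, FF N K, liftOrd_sqfree _ _ (FF_sqfree N K), FF_mem N K d (by omega)⟩

end HK

/-- **Corollary 3.4(a).** Every determinantal ideal `I_t(H)` of a generic `r × s` Hankel
matrix (with `t ≤ min(r,s)`) is a Knutson ideal: it belongs to `C_f` for some polynomial `f`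
whose leading term with respect to some term order is a squarefree monomial. -/
theorem hankel_minors_knutson {K : Type*} [Field K] (r s t : ℕ) (ht : t ≤ min r s) :
    ∃ (ord : MonomialOrder (Fin (r + s - 1))) (f : MvPolynomial (Fin (r + s - 1)) K),
      ord.HasSqfreeLeadTerm f ∧ KnutsonFamily f (minorsIdeal t (hankelGen K r s)) := by
  exact HK.final r s t ht
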